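/- arXiv:math/0408191 — 6 statements merged into one kernel-verified Lean document; each statement's English description precedes it below -/
import Mathlib

section
/- Let ε ↦ u(ε) be a map from (0,∞) to H such that for every ε > 0 the element u(ε) is a (δ,ε)-approximate minimizer, and assume the function h(ε) := ‖A u(ε) − f_δ‖ is continuous on (0,∞). Then the equation h(ε) = Cδ has a solution ε = ε(δ) > 0. (Theorem 1, part j: solvability of the new discrepancy-principle equation.) -/
/-- The Tikhonov functional is bounded below, so its infimum is at most each of its values. -/
theorem iInf_tikhonov_le {H : Type*} [NormedAddCommGroup H] [InnerProductSpace ℝ H]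
    (A : H →L[ℝ] H) (g : H) {ε : ℝ} (hε : 0 ≤ ε) (w : H) :
    (⨅ v : H, (‖A v - g‖ ^ 2 + ε * ‖v‖ ^ 2)) ≤ ‖A w - g‖ ^ 2 + ε * ‖w‖ ^ 2 :=
  ciInf_le ⟨0, by rintro _ ⟨v, rfl⟩; positivity⟩ w

/-- Theorem 1, part (j): solvability of the new discrepancy-principle equation.
If for every `ε > 0`, `u ε` is a `(δ,ε)`-approximate minimizer of
`F_ε(v) = ‖A v - f_δ‖² + ε ‖v‖²` (i.e. `F_ε (u ε) ≤ inf F_ε + (C² - 1 - b) δ²`),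
and `ε ↦ ‖A (u ε) - f_δ‖` is continuous on `(0,∞)`, then the equation
`‖A (u ε) - f_δ‖ = C δ` has a solution `ε > 0`. -/
theorem discrepancy_equation_solvable
    {H : Type*} [NormedAddCommGroup H] [InnerProductSpace ℝ H] [CompleteSpace H]
    (A : H →L[ℝ] H) (f y : H)
    (hAy : A y = f) (hy : ∀ w : H, A w = f → ‖y‖ ≤ ‖w‖)
    (δ : ℝ) (hδ : 0 < δ) (fδ : H) (hfδ : ‖fδ - f‖ ≤ δ)
    (C b : ℝ) (hC : 1 < C) (hb : 0 < b) (hCb : 1 + b < C ^ 2)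
    (hfδC : C * δ < ‖fδ‖)
    (u : ℝ → H)
    (hu : ∀ ε : ℝ, 0 < ε →
      ‖A (u ε) - fδ‖ ^ 2 + ε * ‖u ε‖ ^ 2 ≤
        (⨅ v : H, (‖A v - fδ‖ ^ 2 + ε * ‖v‖ ^ 2)) + (C ^ 2 - 1 - b) * δ ^ 2)
    (hcont : ContinuousOn (fun ε : ℝ => ‖A (u ε) - fδ‖) (Set.Ioi (0 : ℝ))) :
    ∃ ε : ℝ, 0 < ε ∧ ‖A (u ε) - fδ‖ = C * δ := by
  have small : ∃ ε : ℝ, 0 < ε ∧ ‖A (u ε) - fδ‖ ≤ C * δ := by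
    have hε : 0 < b * δ ^ 2 / (‖y‖ ^ 2 + 1) := by positivity
    refine ⟨_, hε, ?_⟩
    set ε := b * δ ^ 2 / (‖y‖ ^ 2 + 1)
    have hεy : ε * (‖y‖ ^ 2 + 1) = b * δ ^ 2 := div_mul_cancel₀ _ (by positivity)
    have hinf := iInf_tikhonov_le A fδ hε.le y
    rw [hAy, norm_sub_rev] at hinf
    have hnoise : ‖fδ - f‖ ^ 2 ≤ δ ^ 2 := by gcongr
    have hpen : 0 ≤ ε * ‖u ε‖ ^ 2 := by positivity
    have hmin := hu ε hε
    refine le_of_pow_le_pow_left₀ two_ne_zero (by positivity) ?_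
    nlinarith
  have large : ∃ ε : ℝ, 0 < ε ∧ C * δ ≤ ‖A (u ε) - fδ‖ := by
    set K := ‖fδ‖ ^ 2 + (C ^ 2 - 1 - b) * δ ^ 2 with hK
    have hK0 : 0 ≤ K := by
      have : 0 < C ^ 2 - 1 - b := by linarith
      positivity
    have hgap : 0 < ‖fδ‖ - C * δ := sub_pos.mpr hfδC
    have hε : 0 < (K * ‖A‖ ^ 2 + 1) / (‖fδ‖ - C * δ) ^ 2 := by positivity
    refine ⟨_, hε, ?_⟩
    set ε := (K * ‖A‖ ^ 2 + 1) / (‖fδ‖ - C * δ) ^ 2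
    have hεgap : ε * (‖fδ‖ - C * δ) ^ 2 = K * ‖A‖ ^ 2 + 1 := div_mul_cancel₀ _ (by positivity)
    have hinf := iInf_tikhonov_le A fδ hε.le 0
    simp only [map_zero, zero_sub, norm_neg, norm_zero] at hinf
    have hpen : ε * ‖u ε‖ ^ 2 ≤ K := by nlinarith [hu ε hε, sq_nonneg ‖A (u ε) - fδ‖]
    have hAu : ‖A‖ * ‖u ε‖ ≤ ‖fδ‖ - C * δ := by
      refine le_of_pow_le_pow_left₀ two_ne_zero hgap.le (le_of_mul_le_mul_left ?_ hε)
      calc ε * (‖A‖ * ‖u ε‖) ^ 2 = ε * ‖u ε‖ ^ 2 * ‖A‖ ^ 2 := by ring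
        _ ≤ K * ‖A‖ ^ 2 := by gcongr
        _ ≤ ε * (‖fδ‖ - C * δ) ^ 2 := by linarith
    have htri := norm_sub_norm_le fδ (A (u ε))
    rw [norm_sub_rev] at htri
    linarith [A.le_opNorm (u ε)]
  obtain ⟨ε₁, hε₁, h₁⟩ := small
  obtain ⟨ε₂, hε₂, h₂⟩ := large
  obtain ⟨ε, hε, h⟩ := isPreconnected_Ioi.intermediate_value hε₁ hε₂ hcont ⟨h₁, h₂⟩
  exact ⟨ε, hε, h⟩
end

section
/- Suppose that for every δ in some interval (0, δ₀] one is given f_δ ∈ H with ‖f_δ − f‖ ≤ δ and ‖f_δ‖ > Cδ, a regularization parameter ε(δ) > 0, and an element u_δ ∈ H which is a (δ, ε(δ))-approximate minimizer and satisfies the discrepancy equation ‖A u_δ − f_δ‖ = Cδ. Then u_δ converges strongly to y as δ → 0, i.e. lim_{δ→0} ‖u_δ − y‖ = 0. (Theorem 1, part jj: convergence of the new discrepancy principle.) -/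
open scoped InnerProductSpace in
/-- A minimal-norm preimage under a bounded operator is orthogonal to its kernel. -/
theorem mem_orthogonal_ker_of_forall_norm_le
    {H : Type*} [NormedAddCommGroup H] [InnerProductSpace ℝ H] (A : H →L[ℝ] H) {y : H}
    (hy : ∀ w : H, A w = A y → ‖y‖ ≤ ‖w‖) : y ∈ A.kerᗮ := by
  rw [Submodule.mem_orthogonal']
  intro k hk
  have hAk : A k = 0 := hk
  by_cases hk0 : k = 0
  · simp [hk0]
  have hkpos : 0 < ‖k‖ ^ 2 := by positivity
  have h := hy (y - (⟪y, k⟫_ℝ / ‖k‖ ^ 2) • k) (by simp [hAk])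
  have hsq : ‖y‖ ^ 2 ≤ ‖y - (⟪y, k⟫_ℝ / ‖k‖ ^ 2) • k‖ ^ 2 := by gcongr
  rw [norm_sub_sq_real, inner_smul_right, norm_smul, mul_pow, Real.norm_eq_abs, sq_abs] at hsq
  have hcancel : (⟪y, k⟫_ℝ / ‖k‖ ^ 2) ^ 2 * ‖k‖ ^ 2 = ⟪y, k⟫_ℝ / ‖k‖ ^ 2 * ⟪y, k⟫_ℝ := by
    field_simp
  have hquot : ⟪y, k⟫_ℝ / ‖k‖ ^ 2 * ⟪y, k⟫_ℝ = ⟪y, k⟫_ℝ ^ 2 / ‖k‖ ^ 2 := by ring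
  have hle : ⟪y, k⟫_ℝ ^ 2 / ‖k‖ ^ 2 ≤ 0 := by linarith
  have hle' : ⟪y, k⟫_ℝ ^ 2 ≤ 0 := by
    by_contra! hpos
    exact absurd hle (not_le.mpr (div_pos hpos hkpos))
  exact pow_eq_zero_iff two_ne_zero |>.mp (le_antisymm hle' (sq_nonneg _))

open Filter Topology in
open scoped InnerProductSpace in
/-- If `‖u i‖ ≤ ‖y‖` eventually and `A (u i) → A y`, where `y` is orthogonal to the kernel of `A`,
then `u i → y` in norm. -/
theorem tendsto_of_norm_le_of_tendsto_apply
    {H ι : Type*} [NormedAddCommGroup H] [InnerProductSpace ℝ H] [CompleteSpace H]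
    (A : H →L[ℝ] H) {y : H} (hy : y ∈ A.kerᗮ) {l : Filter ι} {u : ι → H}
    (hu : ∀ᶠ i in l, ‖u i‖ ≤ ‖y‖) (hAu : Tendsto (fun i => A (u i)) l (𝓝 (A y))) :
    Tendsto u l (𝓝 y) := by
  rw [A.orthogonal_ker] at hy
  have hinner : Tendsto (fun i => ⟪y - u i, y⟫_ℝ) l (𝓝 0) := by
    rw [Metric.tendsto_nhds]
    intro r hr
    obtain ⟨_, ⟨z, rfl⟩, hz⟩ := Metric.mem_closure_iff.mp hy (r / (2 * (2 * ‖y‖ + 1)))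
      (by positivity)
    have hAz : Tendsto (fun i => ⟪A y - A (u i), z⟫_ℝ) l (𝓝 0) := by
      simpa using ((tendsto_const_nhds (x := A y)).sub hAu).inner (𝕜 := ℝ)
        (tendsto_const_nhds (x := z))
    filter_upwards [hu, Metric.tendsto_nhds.mp hAz (r / 2) (by positivity)] with i hi hzi
    rw [dist_zero_right, Real.norm_eq_abs] at hzi ⊢
    rw [dist_eq_norm] at hz
    have hsplit : ⟪y - u i, y⟫_ℝ =
        ⟪y - u i, y - A.adjoint z⟫_ℝ + ⟪A y - A (u i), z⟫_ℝ := by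
      rw [← map_sub, ← A.adjoint_inner_right, ← inner_add_right, sub_add_cancel]
    have hdiff : ‖y - u i‖ ≤ 2 * ‖y‖ + 1 := by linarith [norm_sub_le y (u i)]
    have hfirst : |⟪y - u i, y - A.adjoint z⟫_ℝ| ≤ r / 2 := by
      calc |⟪y - u i, y - A.adjoint z⟫_ℝ| ≤ ‖y - u i‖ * ‖y - A.adjoint z‖ :=
            abs_real_inner_le_norm _ _
        _ ≤ (2 * ‖y‖ + 1) * (r / (2 * (2 * ‖y‖ + 1))) := by
            gcongr
            exact hz.le
        _ = r / 2 := by field_simp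
    rw [hsplit]
    linarith [abs_add_le ⟪y - u i, y - A.adjoint z⟫_ℝ ⟪A y - A (u i), z⟫_ℝ]
  have hsq : Tendsto (fun i => ‖u i - y‖ ^ 2) l (𝓝 0) := by
    refine squeeze_zero' (Eventually.of_forall fun i => sq_nonneg _) ?_
      (by simpa using hinner.const_mul 2)
    filter_upwards [hu] with i hi
    have h2 : ‖u i‖ ^ 2 ≤ ‖y‖ ^ 2 := by gcongr
    rw [norm_sub_sq_real, inner_sub_left, real_inner_self_eq_norm_sq]
    linarith
  rw [tendsto_iff_norm_sub_tendsto_zero]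
  simpa [Real.sqrt_sq] using hsq.sqrt

/-- Theorem 1, part (jj): convergence of the new discrepancy principle.
For each `δ ∈ (0, δ₀]`, suppose `fδ δ` is noisy data with `‖fδ δ - f‖ ≤ δ` and
`‖fδ δ‖ > C δ`, `ε δ > 0`, and `u δ` is a `(δ, ε δ)`-approximate minimizer of
`F(v) = ‖A v - fδ δ‖² + (ε δ) ‖v‖²` satisfying the discrepancy equation
`‖A (u δ) - fδ δ‖ = C δ`. Then `‖u δ - y‖ → 0` as `δ → 0`, where `y` is the
minimal-norm solution of `A u = f`. -/
theorem discrepancy_principle_convergence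
    {H : Type*} [NormedAddCommGroup H] [InnerProductSpace ℝ H] [CompleteSpace H]
    (A : H →L[ℝ] H) (f y : H)
    (hAy : A y = f) (hy : ∀ w : H, A w = f → ‖y‖ ≤ ‖w‖)
    (C b : ℝ) (hC : 1 < C) (hb : 0 < b) (hCb : 1 + b < C ^ 2)
    (δ₀ : ℝ) (hδ₀ : 0 < δ₀)
    (fδ : ℝ → H) (ε : ℝ → ℝ) (u : ℝ → H)
    (hfδ : ∀ δ ∈ Set.Ioc (0 : ℝ) δ₀, ‖fδ δ - f‖ ≤ δ)
    (hfδC : ∀ δ ∈ Set.Ioc (0 : ℝ) δ₀, C * δ < ‖fδ δ‖)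
    (hε : ∀ δ ∈ Set.Ioc (0 : ℝ) δ₀, 0 < ε δ)
    (hu : ∀ δ ∈ Set.Ioc (0 : ℝ) δ₀,
      ‖A (u δ) - fδ δ‖ ^ 2 + ε δ * ‖u δ‖ ^ 2 ≤
        (⨅ v : H, (‖A v - fδ δ‖ ^ 2 + ε δ * ‖v‖ ^ 2)) + (C ^ 2 - 1 - b) * δ ^ 2)
    (hdisc : ∀ δ ∈ Set.Ioc (0 : ℝ) δ₀, ‖A (u δ) - fδ δ‖ = C * δ) :
    Filter.Tendsto (fun δ => ‖u δ - y‖) (nhdsWithin 0 (Set.Ioc (0 : ℝ) δ₀)) (nhds 0) := by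
  subst hAy
  have hbound : ∀ δ ∈ Set.Ioc (0 : ℝ) δ₀, ‖u δ‖ ≤ ‖y‖ := by
    intro δ hδ
    have hinf : (⨅ v : H, (‖A v - fδ δ‖ ^ 2 + ε δ * ‖v‖ ^ 2)) ≤
        ‖A y - fδ δ‖ ^ 2 + ε δ * ‖y‖ ^ 2 :=
      ciInf_le ⟨0, by
        rintro _ ⟨v, rfl⟩
        have := hε δ hδ
        positivity⟩ y
    have hnoise : ‖A y - fδ δ‖ ^ 2 ≤ δ ^ 2 := by
      rw [norm_sub_rev]
      gcongr
      exact hfδ δ hδ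
    have hmin := hu δ hδ
    rw [hdisc δ hδ] at hmin
    have hbδ : 0 ≤ b * δ ^ 2 := by positivity
    have hmul : ε δ * ‖u δ‖ ^ 2 ≤ ε δ * ‖y‖ ^ 2 := by linarith
    exact (sq_le_sq₀ (norm_nonneg _) (norm_nonneg _)).mp
      (le_of_mul_le_mul_left hmul (hε δ hδ))
  have hAu : Filter.Tendsto (fun δ => A (u δ)) (nhdsWithin 0 (Set.Ioc (0 : ℝ) δ₀))
      (nhds (A y)) := by
    rw [tendsto_iff_norm_sub_tendsto_zero]
    have hlim : Filter.Tendsto (fun δ : ℝ => (C + 1) * δ) (nhdsWithin 0 (Set.Ioc (0 : ℝ) δ₀))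
        (nhds 0) := by
      have hcont : Continuous fun δ : ℝ => (C + 1) * δ := by fun_prop
      simpa using (hcont.tendsto 0).mono_left nhdsWithin_le_nhds
    refine squeeze_zero' (Filter.Eventually.of_forall fun δ => norm_nonneg _) ?_ hlim
    filter_upwards [self_mem_nhdsWithin] with δ hδ
    linarith [norm_sub_le_norm_sub_add_norm_sub (A (u δ)) (fδ δ) (A y), hdisc δ hδ, hfδ δ hδ]
  exact tendsto_iff_norm_sub_tendsto_zero.mp <|
    tendsto_of_norm_le_of_tendsto_apply A (mem_orthogonal_ker_of_forall_norm_le A hy)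
      (Filter.eventually_of_mem self_mem_nhdsWithin hbound) hAu
end

section
/- If u_{δ,ε} is a (δ,ε)-approximate minimizer, then ‖A u_{δ,ε} − f_δ‖² ≤ ε‖y‖² + (C² − b)δ², where y is the minimal-norm solution of Au = f. -/
/-- If `u` is a `(δ,ε)`-approximate minimizer, then
`‖A u - f_δ‖² ≤ ε ‖y‖² + (C² - b) δ²`, where `y` is the minimal-norm
solution of `A u = f`. -/
theorem approx_minimizer_discrepancy_upper_bound
    {H : Type*} [NormedAddCommGroup H] [InnerProductSpace ℝ H] [CompleteSpace H]
    (A : H →L[ℝ] H) (f y : H)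
    (hAy : A y = f) (hy : ∀ w : H, A w = f → ‖y‖ ≤ ‖w‖)
    (δ : ℝ) (hδ : 0 < δ) (fδ : H) (hfδ : ‖fδ - f‖ ≤ δ)
    (C b : ℝ) (hC : 1 < C) (hb : 0 < b) (hCb : 1 + b < C ^ 2)
    (hfδC : C * δ < ‖fδ‖)
    (ε : ℝ) (hε : 0 < ε) (u : H)
    (hu : ‖A u - fδ‖ ^ 2 + ε * ‖u‖ ^ 2 ≤
      (⨅ v : H, (‖A v - fδ‖ ^ 2 + ε * ‖v‖ ^ 2)) + (C ^ 2 - 1 - b) * δ ^ 2) :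
    ‖A u - fδ‖ ^ 2 ≤ ε * ‖y‖ ^ 2 + (C ^ 2 - b) * δ ^ 2 := by
  have hinf : (⨅ v : H, (‖A v - fδ‖ ^ 2 + ε * ‖v‖ ^ 2)) ≤ ‖A y - fδ‖ ^ 2 + ε * ‖y‖ ^ 2 :=
    ciInf_le ⟨0, by rintro _ ⟨v, rfl⟩; positivity⟩ y
  have hres : ‖A y - fδ‖ ^ 2 ≤ δ ^ 2 := by
    rw [hAy, norm_sub_rev]
    gcongr
  have hpen : 0 ≤ ε * ‖u‖ ^ 2 := by positivity
  linarith
end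

section
/- Let ε ↦ u(ε) be a map from (0,∞) to H such that for every ε > 0 the element u(ε) is a (δ,ε)-approximate minimizer. Then lim_{ε→∞} ‖A u(ε) − f_δ‖ = ‖f_δ‖; in particular, since ‖f_δ‖ > Cδ, one has ‖A u(ε) − f_δ‖ > Cδ for all sufficiently large ε. -/
/-- If `u ε` is a `(δ,ε)`-approximate minimizer for every `ε > 0`, then
`‖A (u ε) - f_δ‖ → ‖f_δ‖` as `ε → ∞`; in particular, since `‖f_δ‖ > C δ`,
one has `‖A (u ε) - f_δ‖ > C δ` for all sufficiently large `ε`. -/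
theorem discrepancy_tendsto_at_top
    {H : Type*} [NormedAddCommGroup H] [InnerProductSpace ℝ H] [CompleteSpace H]
    (A : H →L[ℝ] H) (f y : H)
    (hAy : A y = f) (hy : ∀ w : H, A w = f → ‖y‖ ≤ ‖w‖)
    (δ : ℝ) (hδ : 0 < δ) (fδ : H) (hfδ : ‖fδ - f‖ ≤ δ)
    (C b : ℝ) (hC : 1 < C) (hb : 0 < b) (hCb : 1 + b < C ^ 2)
    (hfδC : C * δ < ‖fδ‖)
    (u : ℝ → H)
    (hu : ∀ ε : ℝ, 0 < ε →
      ‖A (u ε) - fδ‖ ^ 2 + ε * ‖u ε‖ ^ 2 ≤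
        (⨅ v : H, (‖A v - fδ‖ ^ 2 + ε * ‖v‖ ^ 2)) + (C ^ 2 - 1 - b) * δ ^ 2) :
    Filter.Tendsto (fun ε => ‖A (u ε) - fδ‖) Filter.atTop (nhds ‖fδ‖) ∧
      ∀ᶠ ε in Filter.atTop, C * δ < ‖A (u ε) - fδ‖ := by
  set K : ℝ := ‖fδ‖ ^ 2 + (C ^ 2 - 1 - b) * δ ^ 2
  have hbound : ∀ ε : ℝ, 0 < ε → ‖u ε‖ ^ 2 ≤ K / ε := by
    intro ε hε
    have hbdd : BddBelow (Set.range fun v : H => ‖A v - fδ‖ ^ 2 + ε * ‖v‖ ^ 2) :=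
      ⟨0, by rintro _ ⟨v, rfl⟩; positivity⟩
    have hinf : (⨅ v : H, (‖A v - fδ‖ ^ 2 + ε * ‖v‖ ^ 2)) ≤ ‖fδ‖ ^ 2 := by
      simpa using ciInf_le hbdd 0
    rw [le_div_iff₀ hε]
    linarith [hu ε hε, sq_nonneg ‖A (u ε) - fδ‖]
  have hsq : Filter.Tendsto (fun ε => ‖u ε‖ ^ 2) Filter.atTop (nhds 0) :=
    tendsto_of_tendsto_of_tendsto_of_le_of_le' tendsto_const_nhds
      (tendsto_const_nhds.div_atTop Filter.tendsto_id)
      (Filter.Eventually.of_forall fun _ => sq_nonneg _)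
      ((Filter.eventually_gt_atTop 0).mono hbound)
  have hu_zero : Filter.Tendsto u Filter.atTop (nhds 0) := by
    rw [tendsto_zero_iff_norm_tendsto_zero]
    simpa using hsq.sqrt
  have hlim : Filter.Tendsto (fun ε => ‖A (u ε) - fδ‖) Filter.atTop (nhds ‖fδ‖) := by
    simpa using (((A.continuous.tendsto 0).comp hu_zero).sub_const fδ).norm
  exact ⟨hlim, hlim.eventually_const_lt hfδC⟩
end

section
/- If u_{δ,ε} is a (δ,ε)-approximate minimizer and ε > 0 satisfies ε‖y‖² < bδ², then ‖A u_{δ,ε} − f_δ‖ < Cδ; in particular, for all sufficiently small ε > 0 the discrepancy ‖A u_{δ,ε} − f_δ‖ is strictly less than Cδ. -/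
/-- If `u ε` is a `(δ,ε)`-approximate minimizer and `ε ‖y‖² < b δ²`, then
`‖A (u ε) - f_δ‖ < C δ`; in particular, for all sufficiently small `ε > 0`
the discrepancy `‖A (u ε) - f_δ‖` is strictly less than `C δ`. -/
theorem discrepancy_small_for_small_eps
    {H : Type*} [NormedAddCommGroup H] [InnerProductSpace ℝ H] [CompleteSpace H]
    (A : H →L[ℝ] H) (f y : H)
    (hAy : A y = f) (hy : ∀ w : H, A w = f → ‖y‖ ≤ ‖w‖)
    (δ : ℝ) (hδ : 0 < δ) (fδ : H) (hfδ : ‖fδ - f‖ ≤ δ)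
    (C b : ℝ) (hC : 1 < C) (hb : 0 < b) (hCb : 1 + b < C ^ 2)
    (hfδC : C * δ < ‖fδ‖)
    (u : ℝ → H)
    (hu : ∀ ε : ℝ, 0 < ε →
      ‖A (u ε) - fδ‖ ^ 2 + ε * ‖u ε‖ ^ 2 ≤
        (⨅ v : H, (‖A v - fδ‖ ^ 2 + ε * ‖v‖ ^ 2)) + (C ^ 2 - 1 - b) * δ ^ 2) :
    (∀ ε : ℝ, 0 < ε → ε * ‖y‖ ^ 2 < b * δ ^ 2 → ‖A (u ε) - fδ‖ < C * δ) ∧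
      ∀ᶠ ε in nhdsWithin 0 (Set.Ioi (0 : ℝ)), ‖A (u ε) - fδ‖ < C * δ := by
  have discrepancy_lt : ∀ ε : ℝ, 0 < ε → ε * ‖y‖ ^ 2 < b * δ ^ 2 →
      ‖A (u ε) - fδ‖ < C * δ := by
    intro ε hε hεy
    have hbdd : BddBelow (Set.range fun v : H => ‖A v - fδ‖ ^ 2 + ε * ‖v‖ ^ 2) :=
      ⟨0, by rintro _ ⟨v, rfl⟩; positivity⟩
    have hinf : (⨅ v : H, (‖A v - fδ‖ ^ 2 + ε * ‖v‖ ^ 2)) ≤ ‖A y - fδ‖ ^ 2 + ε * ‖y‖ ^ 2 :=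
      ciInf_le hbdd y
    have hres : ‖A y - fδ‖ ^ 2 ≤ δ ^ 2 := by
      rw [hAy, norm_sub_rev]
      gcongr
    have hpen : 0 ≤ ε * ‖u ε‖ ^ 2 := by positivity
    refine lt_of_pow_lt_pow_left₀ 2 (by positivity) ?_
    linarith [hu ε hε, mul_pow C δ 2]
  refine ⟨discrepancy_lt, ?_⟩
  have hlim : Filter.Tendsto (fun ε : ℝ => ε * ‖y‖ ^ 2) (nhds 0) (nhds 0) :=
    Continuous.tendsto' (by fun_prop) _ _ (zero_mul _)
  have hbδ : 0 < b * δ ^ 2 := by positivity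
  filter_upwards [self_mem_nhdsWithin, nhdsWithin_le_nhds (hlim.eventually_lt_const hbδ)]
    with ε hε hεy using discrepancy_lt ε hε hεy
end

section
/- Suppose u_δ is a (δ,ε)-approximate minimizer for some ε > 0 and satisfies the discrepancy equation ‖A u_δ − f_δ‖ = Cδ. Then for every solution w of Aw = f one has ε‖u_δ‖² + bδ² ≤ ε‖w‖²; in particular ‖u_δ‖ ≤ ‖w‖ for every solution w of equation Aw = f. -/
/-- If `u` is a `(δ,ε)`-approximate minimizer satisfying the discrepancy
equation `‖A u - f_δ‖ = C δ`, then for every solution `w` of `A w = f` one has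
`ε ‖u‖² + b δ² ≤ ε ‖w‖²`; in particular `‖u‖ ≤ ‖w‖` for every such `w`. -/
theorem norm_le_of_discrepancy_eq
    {H : Type*} [NormedAddCommGroup H] [InnerProductSpace ℝ H] [CompleteSpace H]
    (A : H →L[ℝ] H) (f y : H)
    (hAy : A y = f) (hy : ∀ w : H, A w = f → ‖y‖ ≤ ‖w‖)
    (δ : ℝ) (hδ : 0 < δ) (fδ : H) (hfδ : ‖fδ - f‖ ≤ δ)
    (C b : ℝ) (hC : 1 < C) (hb : 0 < b) (hCb : 1 + b < C ^ 2)
    (hfδC : C * δ < ‖fδ‖)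
    (ε : ℝ) (hε : 0 < ε) (u : H)
    (hu : ‖A u - fδ‖ ^ 2 + ε * ‖u‖ ^ 2 ≤
      (⨅ v : H, (‖A v - fδ‖ ^ 2 + ε * ‖v‖ ^ 2)) + (C ^ 2 - 1 - b) * δ ^ 2)
    (hdisc : ‖A u - fδ‖ = C * δ) :
    ∀ w : H, A w = f → ε * ‖u‖ ^ 2 + b * δ ^ 2 ≤ ε * ‖w‖ ^ 2 ∧ ‖u‖ ≤ ‖w‖ := by
  intro w hw
  have hbdd : BddBelow (Set.range fun v : H => ‖A v - fδ‖ ^ 2 + ε * ‖v‖ ^ 2) :=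
    ⟨0, by rintro _ ⟨v, rfl⟩; positivity⟩
  have hinf := ciInf_le hbdd w
  have hres : ‖A w - fδ‖ ^ 2 ≤ δ ^ 2 := by
    rw [hw, norm_sub_rev]
    gcongr
  rw [hdisc] at hu
  have hmain : ε * ‖u‖ ^ 2 + b * δ ^ 2 ≤ ε * ‖w‖ ^ 2 := by
    linarith
  refine ⟨hmain, ?_⟩
  have hbδ : 0 < b * δ ^ 2 := by positivity
  have hsq : ‖u‖ ^ 2 ≤ ‖w‖ ^ 2 := le_of_mul_le_mul_left (by linarith) hε
  exact (sq_le_sq₀ (norm_nonneg u) (norm_nonneg w)).mp hsq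
end
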